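/- Let θ ≥ 2 and β ∈ ℝ. The equation F'(u) = β has exactly three real solutions if and only if β ∈ (F'(u_+), F'(u_−)), where u_± := ±(2θ − 1)^{−1/2} and F'(u_±) = ∓(2θ−1)^{1/2−θ}(2θ−2)^{θ−1}. -/

import Mathlib

open Set MeasureTheory intervalIntegral Filter Topology

noncomputable def F (θ u : ℝ) : ℝ := (1 / (2 * θ)) * |1 - u ^ 2| ^ θ

noncomputable def F' (θ u : ℝ) : ℝ := -u * (1 - u ^ 2) * |1 - u ^ 2| ^ (θ - 2)

noncomputable def G (θ β u : ℝ) : ℝ := F θ u - β * u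

noncomputable def uminus (θ : ℝ) : ℝ := -((2 * θ - 1) ^ (-(1 : ℝ) / 2))

noncomputable def uplus (θ : ℝ) : ℝ := (2 * θ - 1) ^ (-(1 : ℝ) / 2)


theorem F'_eq (θ u : ℝ) : F' θ u = -u * (1 - u ^ 2) * ((1 - u ^ 2) ^ 2) ^ ((θ - 2) / 2) := by
  unfold F'
  congr 1
  rw [← sq_abs (1 - u ^ 2), ← Real.rpow_natCast |1 - u ^ 2| 2, ← Real.rpow_mul (abs_nonneg _)]
  congr 1
  push_cast
  ring

theorem F'_cont (θ : ℝ) (hθ : 2 ≤ θ) : Continuous (F' θ) := by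
  have : F' θ = fun u => -u * (1 - u ^ 2) * ((1 - u ^ 2) ^ 2) ^ ((θ - 2) / 2) :=
    funext (F'_eq θ)
  rw [this]
  refine Continuous.mul (by fun_prop) (Continuous.rpow_const (by fun_prop) ?_)
  intro x
  right
  linarith

theorem F'_odd (θ u : ℝ) : F' θ (-u) = -F' θ u := by
  unfold F'
  rw [neg_sq]
  ring

theorem F'_deriv (θ u : ℝ) (hu : 1 - u ^ 2 ≠ 0) :
    deriv (F' θ) u = ((1 - u ^ 2) ^ 2) ^ ((θ - 2) / 2) * ((2 * θ - 1) * u ^ 2 - 1) := by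
  have e : F' θ = fun u => -u * (1 - u ^ 2) * ((1 - u ^ 2) ^ 2) ^ ((θ - 2) / 2) :=
    funext (F'_eq θ)
  have hs : 0 < (1 - u ^ 2) ^ 2 := by positivity
  have h1 : HasDerivAt (fun u : ℝ => 1 - u ^ 2) (-(2 * u)) u := by
    simpa using (hasDerivAt_pow 2 u).const_sub 1
  have h2 : HasDerivAt (fun u : ℝ => (1 - u ^ 2) ^ 2) (2 * (1 - u ^ 2) * (-(2 * u))) u := by
    refine (h1.pow 2).congr_deriv ?_
    simp
  have h3 := h2.rpow_const (p := (θ - 2) / 2) (Or.inl hs.ne')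
  have h4 := ((hasDerivAt_id u).neg.mul h1).mul h3
  rw [e]
  refine HasDerivAt.deriv (h4.congr_deriv ?_)
  rw [Real.rpow_sub_one hs.ne']
  simp only [Pi.mul_apply, Pi.neg_apply, id]
  field_simp
  ring

theorem count_aux (f : ℝ → ℝ) (a β : ℝ) (h : ∀ u, f u = β → u ≤ -a ∨ a ≤ u)
    (h1 : StrictMonoOn f (Iic (-a))) (h2 : StrictMonoOn f (Ici a)) :
    {u : ℝ | f u = β}.ncard ≠ 3 := by
  intro h3
  obtain ⟨x, y, z, hxy, hxz, hyz, hS⟩ := Set.ncard_eq_three.1 h3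
  have hx : f x = β := by
    have : x ∈ {u : ℝ | f u = β} := by rw [hS]; simp
    exact this
  have hy : f y = β := by
    have : y ∈ {u : ℝ | f u = β} := by rw [hS]; simp
    exact this
  have hz : f z = β := by
    have : z ∈ {u : ℝ | f u = β} := by rw [hS]; simp
    exact this
  have i1 : ∀ p q, f p = β → f q = β → p ≤ -a → q ≤ -a → p = q :=
    fun p q hp hq h h' => h1.injOn h h' (hp.trans hq.symm)
  have i2 : ∀ p q, f p = β → f q = β → a ≤ p → a ≤ q → p = q :=
    fun p q hp hq h h' => h2.injOn h h' (hp.trans hq.symm)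
  rcases h x hx with h4 | h4 <;> rcases h y hy with h5 | h5 <;> rcases h z hz with h6 | h6 <;>
    grind

theorem count_main (f : ℝ → ℝ) (a β : ℝ) (ha : 0 < a) (hc : Continuous f)
    (hodd : ∀ u, f (-u) = -f u) (h2 : StrictMonoOn f (Ici a)) (h0 : StrictAntiOn f (Icc 0 a))
    (hinf : ∀ u, 2 ≤ u → u ≤ f u) :
    {u : ℝ | f u = β}.ncard = 3 ↔ β ∈ Ioo (f a) (f (-a)) := by
  have h1 : StrictMonoOn f (Iic (-a)) := by
    intro x hx y hy hxy
    have hx' : x ≤ -a := hx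
    have hy' : y ≤ -a := hy
    have := h2 (show a ≤ -y by linarith) (show a ≤ -x by linarith) (by linarith)
    rw [hodd, hodd] at this
    linarith
  have h0' : StrictAntiOn f (Icc (-a) 0) := by
    intro x hx y hy hxy
    have := h0 (show -y ∈ Icc 0 a from ⟨by linarith [hy.2], by linarith [hy.1]⟩)
      (show -x ∈ Icc 0 a from ⟨by linarith [hx.2], by linarith [hx.1]⟩) (by linarith)
    rw [hodd, hodd] at this
    linarith
  have hA : StrictAntiOn f (Icc (-a) a) := by
    rw [← Icc_union_Icc_eq_Icc (show -a ≤ 0 by linarith) ha.le]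
    exact h0'.union h0 (isGreatest_Icc (by linarith)) (isLeast_Icc ha.le)
  constructor
  · intro h3
    by_contra hb
    refine count_aux f a β ?_ h1 h2 h3
    intro u hu
    by_contra hcon
    push Not at hcon
    apply hb
    rw [← hu]
    exact ⟨hA ⟨hcon.1.le, hcon.2.le⟩ ⟨by linarith, le_rfl⟩ hcon.2,
      hA ⟨le_rfl, by linarith⟩ ⟨hcon.1.le, hcon.2.le⟩ hcon.1⟩
  · rintro ⟨hb1, hb2⟩
    set R := max (max 2 a) (|β|) with hR
    have hR2 : 2 ≤ R := (le_max_left _ _).trans (le_max_left _ _)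
    have hRa : a ≤ R := (le_max_right _ _).trans (le_max_left _ _)
    have hRb : |β| ≤ R := le_max_right _ _
    have hfR := hinf R hR2
    have hab := abs_le.1 hRb
    obtain ⟨x3, hx3, e3⟩ := intermediate_value_Icc hRa hc.continuousOn
      (show β ∈ Icc (f a) (f R) from ⟨hb1.le, by linarith⟩)
    obtain ⟨x1, hx1, e1⟩ := intermediate_value_Icc (show -R ≤ -a by linarith) hc.continuousOn
      (show β ∈ Icc (f (-R)) (f (-a)) from ⟨by rw [hodd]; linarith, hb2.le⟩)
    obtain ⟨x2, hx2, e2⟩ := intermediate_value_Icc' (show -a ≤ a by linarith) hc.continuousOn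
      (show β ∈ Icc (f a) (f (-a)) from ⟨hb1.le, hb2.le⟩)
    have n1 : x1 ≠ -a := by rintro rfl; linarith
    have n2 : x2 ≠ -a := by rintro rfl; linarith
    have n3 : x2 ≠ a := by rintro rfl; linarith
    have n4 : x3 ≠ a := by rintro rfl; linarith
    have l1 : x1 < -a := lt_of_le_of_ne hx1.2 n1
    have l2 : -a < x2 := lt_of_le_of_ne hx2.1 n2.symm
    have l3 : x2 < a := lt_of_le_of_ne hx2.2 n3
    have l4 : a < x3 := lt_of_le_of_ne hx3.1 n4.symm
    refine Set.ncard_eq_three.2 ⟨x1, x2, x3, (l1.trans l2).ne,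
      (l1.trans (l2.trans (l3.trans l4))).ne, (l3.trans l4).ne, ?_⟩
    ext u
    simp only [mem_ofPred_eq, mem_insert_iff, mem_singleton_iff]
    constructor
    · intro hu
      rcases le_total u (-a) with h | h
      · exact Or.inl (h1.injOn h hx1.2 (hu.trans e1.symm))
      rcases le_total u a with h' | h'
      · exact Or.inr (Or.inl (hA.injOn ⟨h, h'⟩ hx2 (hu.trans e2.symm)))
      · exact Or.inr (Or.inr (h2.injOn h' hx3.1 (hu.trans e3.symm)))
    · rintro (rfl | rfl | rfl) <;> assumption

theorem stmt6 (θ β : ℝ) (hθ : 2 ≤ θ) :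
    (F' θ (uminus θ) = (2 * θ - 1) ^ ((1 : ℝ) / 2 - θ) * (2 * θ - 2) ^ (θ - 1) ∧
      F' θ (uplus θ) = -((2 * θ - 1) ^ ((1 : ℝ) / 2 - θ) * (2 * θ - 2) ^ (θ - 1))) ∧
    ({u : ℝ | F' θ u = β}.ncard = 3 ↔
      β ∈ Set.Ioo (F' θ (uplus θ)) (F' θ (uminus θ))) := by
  have hp : 0 < 2 * θ - 1 := by linarith
  have hq : 0 < 2 * θ - 2 := by linarith
  have ha : 0 < uplus θ := Real.rpow_pos_of_pos hp _
  have hsq : uplus θ ^ 2 = (2 * θ - 1)⁻¹ := by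
    unfold uplus
    rw [← Real.rpow_natCast, ← Real.rpow_mul hp.le, ← Real.rpow_neg_one]
    norm_num
  have hmul : (2 * θ - 1) * uplus θ ^ 2 = 1 := by
    rw [hsq]; exact mul_inv_cancel₀ hp.ne'
  have hum : uminus θ = -uplus θ := rfl
  have ha1 : uplus θ < 1 := by nlinarith
  have hval : F' θ (uplus θ) = -((2 * θ - 1) ^ ((1 : ℝ) / 2 - θ) * (2 * θ - 2) ^ (θ - 1)) := by
    have ht : 1 - uplus θ ^ 2 = (2 * θ - 2) / (2 * θ - 1) := by
      rw [hsq]; field_simp; ring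
    have htp : 0 < (2 * θ - 2) / (2 * θ - 1) := div_pos hq hp
    have e1 : (2 * θ - 2) / (2 * θ - 1) * ((2 * θ - 2) / (2 * θ - 1)) ^ (θ - 2)
        = (2 * θ - 2) ^ (θ - 1) * (2 * θ - 1) ^ (-(θ - 1)) := by
      rw [Real.rpow_neg hp.le, ← div_eq_mul_inv, ← Real.div_rpow hq.le hp.le,
        show θ - 1 = 1 + (θ - 2) by ring, Real.rpow_add htp, Real.rpow_one]
    have e2 : (2 * θ - 1) ^ ((1 : ℝ) / 2 - θ) = uplus θ * (2 * θ - 1) ^ (-(θ - 1)) := by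
      unfold uplus
      rw [← Real.rpow_add hp]
      congr 1
      ring
    unfold F'
    rw [ht, abs_of_pos htp, mul_assoc, e1, e2]
    ring
  refine ⟨⟨?_, hval⟩, ?_⟩
  · rw [hum, F'_odd, hval, neg_neg]
  rw [hum]
  have hc := F'_cont θ hθ
  refine count_main (F' θ) (uplus θ) β ha hc (F'_odd θ) ?_ ?_ ?_
  · rw [← Icc_union_Ici_eq_Ici ha1.le]
    refine StrictMonoOn.union ?_ ?_ (isGreatest_Icc ha1.le) isLeast_Ici
    · refine strictMonoOn_of_deriv_pos (convex_Icc _ _) hc.continuousOn ?_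
      intro u hu
      rw [interior_Icc] at hu
      have h1 : 0 < 1 - u ^ 2 := by nlinarith [hu.1, hu.2]
      have h2 : uplus θ ^ 2 < u ^ 2 := by nlinarith [hu.1, hu.2]
      rw [F'_deriv θ u h1.ne']
      exact mul_pos (Real.rpow_pos_of_pos (by positivity) _) (by nlinarith)
    · refine strictMonoOn_of_deriv_pos (convex_Ici _) hc.continuousOn ?_
      intro u hu
      rw [interior_Ici] at hu
      have hu' : 1 < u := hu
      have h1 : 1 - u ^ 2 < 0 := by nlinarith
      have h2 : uplus θ ^ 2 < u ^ 2 := by nlinarith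
      rw [F'_deriv θ u h1.ne]
      have : 0 < (1 - u ^ 2) ^ 2 := by nlinarith
      exact mul_pos (Real.rpow_pos_of_pos this _) (by nlinarith)
  · refine strictAntiOn_of_deriv_neg (convex_Icc _ _) hc.continuousOn ?_
    intro u hu
    rw [interior_Icc] at hu
    have h1 : 0 < 1 - u ^ 2 := by nlinarith [hu.1, hu.2]
    have h2 : u ^ 2 < uplus θ ^ 2 := by nlinarith [hu.1, hu.2]
    rw [F'_deriv θ u h1.ne']
    exact mul_neg_of_pos_of_neg (Real.rpow_pos_of_pos (by positivity) _) (by nlinarith)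
  · intro u hu
    have h1 : 1 ≤ u ^ 2 - 1 := by nlinarith
    have h2 : 1 ≤ |1 - u ^ 2| ^ (θ - 2) := by
      refine Real.one_le_rpow ?_ (by linarith)
      rw [abs_sub_comm]
      exact h1.trans (le_abs_self _)
    have h3 : u ≤ -u * (1 - u ^ 2) := by nlinarith
    unfold F'
    exact h3.trans (le_mul_of_one_le_right (by linarith) h2)
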